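/- Let f : ℝ → ℝ be β-times differentiable on [y₀ - b, y₀ + b] with |f^(k)(y)| ≤ 1 for all 0 ≤ k ≤ β and all y in the interval, and |f^(β)(y) - f^(β)(ỹ)| ≤ |y - ỹ|. If y solves y'(x) = f(y(x)) with y(x₀) = y₀ and y(x) ∈ [y₀ - b, y₀ + b] for x ∈ [x₀ - a, x₀ + a], then for all x ∈ [x₀ - α, x₀ + α] with α = min(a,b) and all 1 ≤ k ≤ β + 1, we have |y^(k)(x)| ≤ (k-1)!. -/

import Mathlib

open Set

/-- `PolyBound F r m c g` says that `g` is a sum of `c` products, each with `m` factors taken from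
the functions `F 0, …, F r`. -/
inductive PolyBound (F : ℕ → ℝ → ℝ) : ℕ → ℕ → ℕ → (ℝ → ℝ) → Prop
  | of (i : ℕ) : PolyBound F i 1 1 (F i)
  | mono {r r' m c : ℕ} {g : ℝ → ℝ} (h : r ≤ r') (hg : PolyBound F r m c g) :
      PolyBound F r' m c g
  | mul {r m m' c c' : ℕ} {g h : ℝ → ℝ} (hg : PolyBound F r m c g) (hh : PolyBound F r m' c' h) :
      PolyBound F r (m + m') (c * c') (g * h)
  | add {r m c c' : ℕ} {g h : ℝ → ℝ} (hg : PolyBound F r m c g) (hh : PolyBound F r m c' h) :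
      PolyBound F r m (c + c') (g + h)

namespace PolyBound

variable {F : ℕ → ℝ → ℝ} {r m c β : ℕ} {g : ℝ → ℝ} {s : Set ℝ} {x : ℝ}

theorem abs_le (hg : PolyBound F r m c g) (hF : ∀ i ≤ β, |F i x| ≤ 1) (hr : r ≤ β) :
    |g x| ≤ c := by
  induction hg with
  | of i => simpa using hF i hr
  | mono h _ ih => exact ih (h.trans hr)
  | mul _ _ ihg ihh =>
    rw [Pi.mul_apply, abs_mul, Nat.cast_mul]
    exact mul_le_mul (ihg hr) (ihh hr) (abs_nonneg _) (Nat.cast_nonneg _)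
  | add _ _ ihg ihh =>
    rw [Pi.add_apply, Nat.cast_add]
    exact (abs_add_le _ _).trans (add_le_add (ihg hr) (ihh hr))

theorem exists_hasDerivWithinAt (hg : PolyBound F r m c g)
    (hF : ∀ i < β, ∀ x ∈ s, HasDerivWithinAt (F i) (F (i + 1) x * F 0 x) s x) (hr : r < β) :
    ∃ g', PolyBound F (r + 1) (m + 1) (m * c) g' ∧ ∀ x ∈ s, HasDerivWithinAt g (g' x) s x := by
  induction hg with
  | of i => exact ⟨F (i + 1) * F 0, (of (i + 1)).mul ((of 0).mono (Nat.zero_le _)), hF i hr⟩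
  | mono h _ ih =>
    obtain ⟨g', hg', hd⟩ := ih (h.trans_lt hr)
    exact ⟨g', hg'.mono (Nat.succ_le_succ h), hd⟩
  | @mul r m m' c c' g h hg hh ihg ihh =>
    obtain ⟨g', hg', hdg⟩ := ihg hr
    obtain ⟨h', hh', hdh⟩ := ihh hr
    refine ⟨g' * h + g * h', ?_, fun x hx => (hdg x hx).mul (hdh x hx)⟩
    have h₁ := hg'.mul (hh.mono r.le_succ)
    have h₂ := (hg.mono r.le_succ).mul hh'
    rw [show m + 1 + m' = m + m' + 1 by ring] at h₁
    rw [show (m + m') * (c * c') = m * c * c' + c * (m' * c') by ring]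
    exact h₁.add h₂
  | @add r m c c' g h _ _ ihg ihh =>
    obtain ⟨g', hg', hdg⟩ := ihg hr
    obtain ⟨h', hh', hdh⟩ := ihh hr
    refine ⟨g' + h', ?_, fun x hx => (hdg x hx).add (hdh x hx)⟩
    rw [mul_add]
    exact hg'.add hh'

end PolyBound

theorem exists_polyBound_iteratedDerivWithin {F : ℕ → ℝ → ℝ} {y : ℝ → ℝ} {s : Set ℝ} {β : ℕ}
    (hs : UniqueDiffOn ℝ s) (hy : ∀ x ∈ s, HasDerivWithinAt y (F 0 x) s x)
    (hF : ∀ i < β, ∀ x ∈ s, HasDerivWithinAt (F i) (F (i + 1) x * F 0 x) s x)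
    {n : ℕ} (hn : n ≤ β) :
    ∃ g, PolyBound F n (n + 1) n.factorial g ∧ EqOn (iteratedDerivWithin (n + 1) y s) g s := by
  induction n with
  | zero =>
    refine ⟨F 0, .of 0, fun x hx => ?_⟩
    rw [zero_add, iteratedDerivWithin_one]
    exact (hy x hx).derivWithin (hs x hx)
  | succ n ih =>
    obtain ⟨g, hg, heq⟩ := ih (Nat.le_of_succ_le hn)
    obtain ⟨g', hg', hd⟩ := hg.exists_hasDerivWithinAt hF hn
    refine ⟨g', hg', fun x hx => ?_⟩
    rw [iteratedDerivWithin_succ, derivWithin_congr heq (heq hx)]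
    exact (hd x hx).derivWithin (hs x hx)

theorem autonomous_factorial_derivative_bound
    (β : ℕ) (f y : ℝ → ℝ) (x₀ y₀ a b : ℝ) (ha : 0 < a) (hb : 0 < b)
    (hf : ContDiffOn ℝ (β : ℕ∞) f (Icc (y₀ - b) (y₀ + b)))
    (hbd : ∀ k ≤ β, ∀ z ∈ Icc (y₀ - b) (y₀ + b),
      |iteratedDerivWithin k f (Icc (y₀ - b) (y₀ + b)) z| ≤ 1)
    (hlip : ∀ z ∈ Icc (y₀ - b) (y₀ + b), ∀ z' ∈ Icc (y₀ - b) (y₀ + b),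
      |iteratedDerivWithin β f (Icc (y₀ - b) (y₀ + b)) z -
        iteratedDerivWithin β f (Icc (y₀ - b) (y₀ + b)) z'| ≤ |z - z'|)
    (hy0 : y x₀ = y₀)
    (hode : ∀ x ∈ Icc (x₀ - a) (x₀ + a), HasDerivAt y (f (y x)) x)
    (htraj : ∀ x ∈ Icc (x₀ - a) (x₀ + a), y x ∈ Icc (y₀ - b) (y₀ + b)) :
    ∀ k, 1 ≤ k → k ≤ β + 1 → ∀ x ∈ Icc (x₀ - min a b) (x₀ + min a b),
      |iteratedDerivWithin k y (Icc (x₀ - a) (x₀ + a)) x| ≤ (k - 1).factorial := by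

  intro k hk hkβ x hx
  obtain ⟨n, rfl⟩ : ∃ n, k = n + 1 := ⟨k - 1, by lia⟩
  have hI : UniqueDiffOn ℝ (Icc (y₀ - b) (y₀ + b)) := uniqueDiffOn_Icc (by linarith)
  have hJ : UniqueDiffOn ℝ (Icc (x₀ - a) (x₀ + a)) := uniqueDiffOn_Icc (by linarith)
  have hxJ : x ∈ Icc (x₀ - a) (x₀ + a) :=
    Icc_subset_Icc (by linarith [min_le_left a b]) (by linarith [min_le_left a b]) hx
  obtain ⟨g, hg, heq⟩ := exists_polyBound_iteratedDerivWithin (y := y) (β := β)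
    (F := fun i t => iteratedDerivWithin i f (Icc (y₀ - b) (y₀ + b)) (y t)) hJ
    (fun t ht => by simpa using (hode t ht).hasDerivWithinAt)
    (fun i hi t ht => by
      have hd := (hf.differentiableOn_iteratedDerivWithin (by exact_mod_cast hi) hI
        (y t) (htraj t ht)).hasDerivWithinAt
      rw [← iteratedDerivWithin_succ] at hd
      simp only [iteratedDerivWithin_zero]
      exact hd.comp t (hode t ht).hasDerivWithinAt htraj)
    (Nat.le_of_succ_le_succ hkβ)
  rw [heq hxJ]
  exact hg.abs_le (fun i hi => hbd i hi _ (htraj x hxJ)) (Nat.le_of_succ_le_succ hkβ)
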